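/- Under the (f,Γ)-GAN assumptions (see context), and supposing additionally that inf_{θ∈Θ} D_f^{Γ̃}(μ_n‖P_θ) = 0 for all empirical distributions μ_n, the following holds ℙ-almost surely: D_f^Γ(Q‖P_{θ*_{n,m}}) ≤ sup_{h∈Γ̃,θ∈Θ}{ Λ_f^{P_{Z,m}}[h∘Φ_θ] − Λ_f^{P_Z}[h∘Φ_θ] } + sup_{h∈Γ̃,θ∈Θ}{ Λ_f^{P_Z}[h∘Φ_θ] − Λ_f^{P_{Z,m}}[h∘Φ_θ] } + sup_{h∈Γ̃}{ E_Q[h] − E_{Q_n}[h] } + (1 + (f*)'_+(z₀+β−α)) sup_{h∈Γ} inf_{h̃∈Γ̃} ‖h−h̃‖_∞ + ε^{opt}_{n,m}. -/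

import Mathlib

open MeasureTheory Set Filter Topology
open scoped ENNReal NNReal Classical

noncomputable section

/-- The interval `(a, b)` with `b` possibly infinite. -/
def Dom (a : ℝ) (b : EReal) : Set ℝ := {t : ℝ | a < t ∧ (t : EReal) < b}

/-- Legendre transform of `f` on `(a,b)`, with values in `(-∞, ∞]` (modeled by `EReal`). -/
def fStar (f : ℝ → ℝ) (a : ℝ) (b : EReal) (z : ℝ) : EReal :=
  ⨆ t ∈ Dom a b, ((z * t - f t : ℝ) : EReal)

/-- Real-valued version of the Legendre transform (junk value where it is `⊤`). -/
def fStarR (f : ℝ → ℝ) (a : ℝ) (b : EReal) (z : ℝ) : ℝ := (fStar f a b z).toReal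

/-- Right derivative of `g` at `z`. -/
def rderiv (g : ℝ → ℝ) (z : ℝ) : ℝ := derivWithin g (Ici z) z

/-- `z₀ := f'_+(1)`. -/
def zz (f : ℝ → ℝ) : ℝ := rderiv f 1

/-- Integral of an `EReal`-valued function: the Bochner integral if the function is
a.e. finite and integrable, and `⊤` otherwise. -/
def eIntegral {X : Type*} [MeasurableSpace X] (P : Measure X) (g : X → EReal) : EReal :=
  if (∀ᵐ x ∂P, g x ≠ ⊤) ∧ Integrable (fun x => (g x).toReal) P
  then ((∫ x, (g x).toReal ∂P : ℝ) : EReal) else ⊤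

/-- The generalized cumulant generating function `Λ_f^P[h]`. -/
def cgf {X : Type*} [MeasurableSpace X] (f : ℝ → ℝ) (a : ℝ) (b : EReal)
    (P : Measure X) (h : X → ℝ) : EReal :=
  ⨅ ν : ℝ, ((ν : EReal) + eIntegral P (fun x => fStar f a b (h x - ν)))

/-- Real-valued `Λ_f^P[h]`. -/
def cgfR {X : Type*} [MeasurableSpace X] (f : ℝ → ℝ) (a : ℝ) (b : EReal)
    (P : Measure X) (h : X → ℝ) : ℝ := (cgf f a b P h).toReal

/-- `Λ_f : ℝⁿ → ℝ` (with values in `EReal`). -/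
def lamVec (f : ℝ → ℝ) (a : ℝ) (b : EReal) {n : ℕ} (x : Fin n → ℝ) : EReal :=
  ⨅ ν : ℝ, ((ν : EReal) + ((n : ℝ)⁻¹ : EReal) * ∑ i, fStar f a b (x i - ν))

/-- Empirical measure of `n` points. -/
def empMeas {X : Type*} [MeasurableSpace X] (n : ℕ) (xs : Fin n → X) : Measure X :=
  (n : ℝ≥0∞)⁻¹ • ∑ i, Measure.dirac (xs i)

/-- The `(f,Γ)`-divergence `D_f^Γ(Q‖P)`. -/
def Dfg {X : Type*} [MeasurableSpace X] (f : ℝ → ℝ) (a : ℝ) (b : EReal)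
    (Γ : Set (X → ℝ)) (Q P : Measure X) : ℝ :=
  sSup {r : ℝ | ∃ h ∈ Γ, r = ∫ x, h x ∂Q - cgfR f a b P h}

/-- Empirical Rademacher complexity of `Ψ` at the sample `y`. -/
def empRad {Y : Type*} (Ψ : Set (Y → ℝ)) (n : ℕ) (y : Fin n → Y) : ℝ :=
  (2 ^ n : ℝ)⁻¹ * ∑ σ : Fin n → Bool,
    sSup {r : ℝ | ∃ ψ ∈ Ψ, r = (n : ℝ)⁻¹ * ∑ i, (if σ i then 1 else -1) * ψ (y i)}

/-- Rademacher complexity of `Ψ` relative to `P` with `n` samples. -/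
def rad {Y : Type*} [MeasurableSpace Y] (Ψ : Set (Y → ℝ)) (P : Measure Y) (n : ℕ) : ℝ :=
  ∫ y, empRad Ψ n y ∂(Measure.pi fun _ : Fin n => P)

/-- `Δ_{f,n}`. -/
def Δq (f : ℝ → ℝ) (a : ℝ) (b : EReal) (α β : ℝ) (n : ℕ) : ℝ :=
  sInf ((fun z => (n : ℝ) * (-z + (((n : ℝ) - 1) / (n : ℝ)) * fStarR f a b z
      + (1 / (n : ℝ)) * fStarR f a b (β - α + z))) '' Icc (zz f - (β - α)) (zz f))

/-- `sup_{h ∈ Γ} inf_{h̃ ∈ Γ̃} ‖h − h̃‖_∞`. -/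
def approxErr {X : Type*} (Γ Γt : Set (X → ℝ)) : ℝ :=
  sSup {r : ℝ | ∃ h ∈ Γ, r = sInf {s : ℝ | ∃ ht ∈ Γt, s = ⨆ x, |h x - ht x|}}

/-- A countable subset which is pointwise-limit dense. -/
def PtwiseDenseCount {X : Type*} (Γ : Set (X → ℝ)) : Prop :=
  ∃ Γ₀ ⊆ Γ, Γ₀.Countable ∧ ∀ h ∈ Γ, ∃ s : ℕ → X → ℝ,
    (∀ j, s j ∈ Γ₀) ∧ ∀ x, Tendsto (fun j => s j x) atTop (𝓝 (h x))

/-- The quantity `K_{f,Ψ,P,n}` from Definition 3.4: either `(f*)'_+` is Lipschitz on the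
relevant interval and `Ψ` contains a constant, in which case `K` is the minimum of the two
expressions, or `K` is the second expression. -/
def Kchoice (f : ℝ → ℝ) (a : ℝ) (b : EReal) (α β : ℝ) {Y : Type*} [MeasurableSpace Y]
    (Ψ : Set (Y → ℝ)) (P : Measure Y) (n : ℕ) (K : ℝ) : Prop :=
  (∃ L : ℝ≥0, LipschitzOnWith L (rderiv (fStarR f a b))
      (Icc (zz f - (β - α)) (zz f + (β - α))) ∧
    (∃ c : ℝ, (fun _ => c) ∈ Ψ) ∧
    K = min ((1 + 2 * (β - α) * (L : ℝ)) * rad Ψ P n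
        + (β - α) ^ 2 * (L : ℝ) / (2 * Real.sqrt n))
      (rderiv (fStarR f a b) (β - α + zz f) * (rad Ψ P n + (β - α) / (2 * Real.sqrt n))))
  ∨ K = rderiv (fStarR f a b) (β - α + zz f) * (rad Ψ P n + (β - α) / (2 * Real.sqrt n))

/-- Covering number of a (pseudo)metric space by `ε`-balls. -/
def coverNum (Θ : Type*) [PseudoMetricSpace Θ] (ε : ℝ) : ℝ≥0∞ :=
  ⨅ s ∈ {s : Finset Θ | ∀ θ : Θ, ∃ c ∈ s, dist θ c ≤ ε}, ((s.card : ℝ≥0∞))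

end

section LegendreTransform

variable {f : ℝ → ℝ} {a : ℝ} {b : EReal}

lemma one_mem_Dom (ha1 : a < 1) (hb1 : ((1 : ℝ) : EReal) < b) : (1 : ℝ) ∈ Dom a b := ⟨ha1, hb1⟩

lemma Dom_mem_nhds_one (ha1 : a < 1) (hb1 : ((1 : ℝ) : EReal) < b) : Dom a b ∈ 𝓝 (1 : ℝ) :=
  inter_mem (Ioi_mem_nhds ha1)
    ((isOpen_Iio.preimage continuous_coe_real_ereal).mem_nhds (show ((1 : ℝ) : EReal) < b from hb1))

lemma le_fStar {t : ℝ} (ht : t ∈ Dom a b) (z : ℝ) :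
    ((z * t - f t : ℝ) : EReal) ≤ fStar f a b z :=
  le_iSup₂_of_le t ht le_rfl

lemma self_le_fStar (ha1 : a < 1) (hb1 : ((1 : ℝ) : EReal) < b) (hf1 : f 1 = 0) (z : ℝ) :
    (z : EReal) ≤ fStar f a b z := by
  simpa [hf1] using le_fStar (f := f) (one_mem_Dom ha1 hb1) z

lemma monotone_fStar (ha0 : 0 ≤ a) : Monotone (fStar f a b) := by
  intro x y hxy
  refine iSup₂_le fun t ht => le_trans ?_ (le_fStar ht y)
  exact EReal.coe_le_coe_iff.2
    (sub_le_sub_right (mul_le_mul_of_nonneg_right hxy (ha0.trans ht.1.le)) _)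

lemma coe_fStarR (ha1 : a < 1) (hb1 : ((1 : ℝ) : EReal) < b) (hf1 : f 1 = 0) {z : ℝ}
    (hz : fStar f a b z ≠ ⊤) : ((fStarR f a b z : ℝ) : EReal) = fStar f a b z :=
  EReal.coe_toReal hz
    (ne_bot_of_le_ne_bot (EReal.coe_ne_bot z) (self_le_fStar ha1 hb1 hf1 z))

lemma le_fStarR (ha1 : a < 1) (hb1 : ((1 : ℝ) : EReal) < b) (hf1 : f 1 = 0) {z t : ℝ}
    (hz : fStar f a b z ≠ ⊤) (ht : t ∈ Dom a b) : z * t - f t ≤ fStarR f a b z := by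
  rw [← EReal.coe_le_coe_iff, coe_fStarR ha1 hb1 hf1 hz]
  exact le_fStar ht z

lemma fStarR_le (ha1 : a < 1) (hb1 : ((1 : ℝ) : EReal) < b) (hf1 : f 1 = 0) {z c : ℝ}
    (h : ∀ t ∈ Dom a b, z * t - f t ≤ c) : fStarR f a b z ≤ c := by
  have hle : fStar f a b z ≤ (c : EReal) :=
    iSup₂_le fun t ht => EReal.coe_le_coe_iff.2 (h t ht)
  rw [← EReal.coe_le_coe_iff, coe_fStarR ha1 hb1 hf1 (ne_top_of_le_ne_top (EReal.coe_ne_top c) hle)]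
  exact hle

lemma self_le_fStarR (ha1 : a < 1) (hb1 : ((1 : ℝ) : EReal) < b) (hf1 : f 1 = 0) {z : ℝ}
    (hz : fStar f a b z ≠ ⊤) : z ≤ fStarR f a b z := by
  simpa [hf1] using le_fStarR ha1 hb1 hf1 hz (one_mem_Dom ha1 hb1)

lemma fStarR_mono (ha0 : 0 ≤ a) (ha1 : a < 1) (hb1 : ((1 : ℝ) : EReal) < b) (hf1 : f 1 = 0)
    {x y : ℝ} (hxy : x ≤ y) (hy : fStar f a b y ≠ ⊤) : fStarR f a b x ≤ fStarR f a b y :=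
  EReal.toReal_le_toReal (monotone_fStar ha0 hxy)
    (ne_bot_of_le_ne_bot (EReal.coe_ne_bot x) (self_le_fStar ha1 hb1 hf1 x)) hy

lemma zz_mul_le (ha1 : a < 1) (hb1 : ((1 : ℝ) : EReal) < b) (hconv : ConvexOn ℝ (Dom a b) f)
    (hf1 : f 1 = 0) {t : ℝ} (ht : t ∈ Dom a b) : zz f * (t - 1) ≤ f t := by
  have hint : (1 : ℝ) ∈ interior (Dom a b) := mem_interior_iff_mem_nhds.2 (Dom_mem_nhds_one ha1 hb1)
  have hzz : zz f = derivWithin f (Ioi 1) 1 := (derivWithin_Ioi_eq_Ici f 1).symm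
  rcases lt_trichotomy t 1 with h | rfl | h
  · have h1 : slope f t 1 ≤ derivWithin f (Ioi 1) 1 :=
      (hconv.slope_le_leftDeriv_of_mem_interior ht hint h).trans
        (hconv.leftDeriv_le_rightDeriv_of_mem_interior hint)
    rw [← hzz, slope_def_field, hf1, div_le_iff₀ (by linarith)] at h1
    linarith
  · simp [hf1]
  · have h1 := hconv.rightDeriv_le_slope_of_mem_interior hint ht h
    rw [← hzz, slope_def_field, hf1, le_div_iff₀ (by linarith)] at h1
    linarith

lemma fStar_zz_le (ha1 : a < 1) (hb1 : ((1 : ℝ) : EReal) < b) (hconv : ConvexOn ℝ (Dom a b) f)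
    (hf1 : f 1 = 0) : fStar f a b (zz f) ≤ (zz f : EReal) := by
  refine iSup₂_le fun t ht => EReal.coe_le_coe_iff.2 ?_
  have := zz_mul_le ha1 hb1 hconv hf1 ht
  linarith

lemma fStarR_sub_self_mono (ha1 : a < 1) (hb1 : ((1 : ℝ) : EReal) < b)
    (hconv : ConvexOn ℝ (Dom a b) f) (hf1 : f 1 = 0) {x y : ℝ} (hx : zz f ≤ x) (hxy : x ≤ y)
    (hy : fStar f a b y ≠ ⊤) : fStarR f a b x - x ≤ fStarR f a b y - y := by
  suffices fStarR f a b x ≤ fStarR f a b y - y + x by linarith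
  refine fStarR_le ha1 hb1 hf1 fun t ht => ?_
  rcases le_total 1 t with h | h
  · nlinarith [le_fStarR ha1 hb1 hf1 hy ht]
  · nlinarith [self_le_fStarR ha1 hb1 hf1 hy, zz_mul_le ha1 hb1 hconv hf1 ht]

lemma convexOn_fStarR (ha1 : a < 1) (hb1 : ((1 : ℝ) : EReal) < b) (hf1 : f 1 = 0) {s : Set ℝ}
    (hs : Convex ℝ s) (hfin : ∀ z ∈ s, fStar f a b z ≠ ⊤) : ConvexOn ℝ s (fStarR f a b) := by
  refine ⟨hs, fun x hx y hy p q hp hq hpq => fStarR_le ha1 hb1 hf1 fun t ht => ?_⟩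
  have h1 := mul_le_mul_of_nonneg_left (le_fStarR ha1 hb1 hf1 (hfin x hx) ht) hp
  have h2 := mul_le_mul_of_nonneg_left (le_fStarR ha1 hb1 hf1 (hfin y hy) ht) hq
  simp only [smul_eq_mul]
  have h3 : f t = p * f t + q * f t := by rw [← add_mul, hpq, one_mul]
  linarith

lemma exists_lt_fStar_ne_top {M : ℝ} (hM : M ∈ interior {z : ℝ | fStar f a b z < ⊤}) :
    ∃ N, M < N ∧ fStar f a b N ≠ ⊤ := by
  obtain ⟨ε, hε, hball⟩ := Metric.mem_nhds_iff.1 (mem_interior_iff_mem_nhds.1 hM)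
  refine ⟨M + ε / 2, by linarith, ne_of_lt (hball ?_)⟩
  rw [Metric.mem_ball, Real.dist_eq, add_sub_cancel_left, abs_of_pos (by linarith)]
  linarith

/-- The Legendre transform is nondecreasing and Lipschitz to the left of any interior point `M` of
its domain, with constant its right derivative at `M`. -/
lemma fStarR_le_add_rderiv_mul (ha0 : 0 ≤ a) (ha1 : a < 1) (hb1 : ((1 : ℝ) : EReal) < b)
    (hf1 : f 1 = 0) {M : ℝ} (hM : M ∈ interior {z : ℝ | fStar f a b z < ⊤}) :
    0 ≤ rderiv (fStarR f a b) M ∧ ∀ x ≤ M, ∀ y ≤ M,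
      fStarR f a b x ≤ fStarR f a b y + rderiv (fStarR f a b) M * |x - y| := by
  obtain ⟨N, hMN, hN⟩ := exists_lt_fStar_ne_top hM
  have hfin : ∀ z ≤ N, fStar f a b z ≠ ⊤ := fun z hz => ne_top_of_le_ne_top hN (monotone_fStar ha0 hz)
  have hc : ConvexOn ℝ (Iic N) (fStarR f a b) :=
    convexOn_fStarR ha1 hb1 hf1 (convex_Iic N) fun z hz => hfin z hz
  have hint : M ∈ interior (Iic N) := by rwa [interior_Iic]
  have hr : rderiv (fStarR f a b) M = derivWithin (fStarR f a b) (Ioi M) M :=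
    (derivWithin_Ioi_eq_Ici _ _).symm
  have hslope : ∀ x < M, slope (fStarR f a b) x M ≤ rderiv (fStarR f a b) M := fun x hx => by
    rw [hr]
    exact (hc.slope_le_leftDeriv_of_mem_interior (show x ≤ N by linarith) hint hx).trans
      (hc.leftDeriv_le_rightDeriv_of_mem_interior hint)
  have h0 : 0 ≤ rderiv (fStarR f a b) M := by
    refine le_trans ?_ (hslope (M - 1) (by linarith))
    rw [slope_def_field]
    exact div_nonneg (sub_nonneg.2 (fStarR_mono ha0 ha1 hb1 hf1 (by linarith) (hfin M hMN.le)))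
      (by linarith)
  refine ⟨h0, fun x hx y hy => ?_⟩
  rcases le_or_gt x y with h | h
  · have := fStarR_mono ha0 ha1 hb1 hf1 h (hfin y (by linarith))
    nlinarith [mul_nonneg h0 (abs_nonneg (x - y))]
  · have hsec : slope (fStarR f a b) y x ≤ rderiv (fStarR f a b) M := by
      refine le_trans ?_ (hslope y (by linarith))
      rcases hx.eq_or_lt with rfl | hxM
      · exact le_rfl
      · rw [slope_def_field, slope_def_field]
        exact hc.secant_mono (show y ≤ N by linarith) (show x ≤ N by linarith)
          (show M ≤ N by linarith) h.ne' (by linarith) hx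
    rw [slope_def_field, div_le_iff₀ (by linarith)] at hsec
    rw [abs_of_pos (by linarith)]
    linarith

end LegendreTransform

section Cumulant

variable {Y : Type*} [MeasurableSpace Y] {f : ℝ → ℝ} {a : ℝ} {b : EReal} {α β : ℝ}

lemma eIntegral_map {W : Type*} [MeasurableSpace W] {φ : W → Y} (hφ : Measurable φ)
    (P : Measure W) {g : Y → EReal} (hg : Measurable g) :
    eIntegral (Measure.map φ P) g = eIntegral P (fun w => g (φ w)) := by
  have hr : Measurable fun y => (g y).toReal := hg.ereal_toReal
  have h1 : (∀ᵐ y ∂(Measure.map φ P), g y ≠ ⊤) ↔ ∀ᵐ w ∂P, g (φ w) ≠ ⊤ :=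
    ae_map_iff hφ.aemeasurable (hg (measurableSet_singleton _)).compl
  have h2 : Integrable (fun y => (g y).toReal) (Measure.map φ P) ↔
      Integrable (fun w => (g (φ w)).toReal) P :=
    integrable_map_measure hr.aestronglyMeasurable hφ.aemeasurable
  unfold eIntegral
  rw [integral_map hφ.aemeasurable hr.aestronglyMeasurable]
  simp only [h1, h2]

lemma cgfR_map {W : Type*} [MeasurableSpace W] (ha0 : 0 ≤ a) {φ : W → Y} (hφ : Measurable φ)
    (P : Measure W) {h : Y → ℝ} (hh : Measurable h) :
    cgfR f a b (Measure.map φ P) h = cgfR f a b P (fun w => h (φ w)) := by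
  unfold cgfR cgf
  congr 2 with ν
  rw [eIntegral_map hφ P (g := fun y => fStar f a b (h y - ν))
    ((monotone_fStar ha0).measurable.comp (hh.sub_const ν))]

variable {P : Measure Y} [IsProbabilityMeasure P] {h h' : Y → ℝ}

lemma integrable_fStarR_sub (ha0 : 0 ≤ a) (ha1 : a < 1) (hb1 : ((1 : ℝ) : EReal) < b)
    (hf1 : f 1 = 0) (hh : Measurable h) (hbd : ∀ y, h y ∈ Icc α β) {ν : ℝ}
    (hν : fStar f a b (β - ν) ≠ ⊤) : Integrable (fun y => fStarR f a b (h y - ν)) P := by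
  have hm : Measurable fun y => fStarR f a b (h y - ν) :=
    ((monotone_fStar ha0).measurable.comp (hh.sub_const ν)).ereal_toReal
  refine Integrable.of_mem_Icc (α - ν) (fStarR f a b (β - ν)) hm.aemeasurable (ae_of_all _ fun y => ?_)
  have hle : h y - ν ≤ β - ν := sub_le_sub_right (hbd y).2 ν
  refine ⟨?_, fStarR_mono ha0 ha1 hb1 hf1 hle hν⟩
  have := self_le_fStarR ha1 hb1 hf1 (ne_top_of_le_ne_top hν (monotone_fStar ha0 hle))
  linarith [(hbd y).1]

lemma cgf_le_integral (ha0 : 0 ≤ a) (ha1 : a < 1) (hb1 : ((1 : ℝ) : EReal) < b)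
    (hf1 : f 1 = 0) (hh : Measurable h) (hbd : ∀ y, h y ∈ Icc α β) {ν : ℝ}
    (hν : fStar f a b (β - ν) ≠ ⊤) :
    cgf f a b P h ≤ ((ν + ∫ y, fStarR f a b (h y - ν) ∂P : ℝ) : EReal) := by
  refine (iInf_le _ ν).trans ?_
  rw [eIntegral, if_pos ⟨ae_of_all _ fun y => ne_top_of_le_ne_top hν
    (monotone_fStar ha0 (sub_le_sub_right (hbd y).2 ν)),
    integrable_fStarR_sub ha0 ha1 hb1 hf1 hh hbd hν⟩, EReal.coe_add]
  exact le_rfl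

omit [IsProbabilityMeasure P] in
lemma le_cgf {c : ℝ} (H : ∀ ν : ℝ, (∀ᵐ y ∂P, fStar f a b (h y - ν) ≠ ⊤) →
      Integrable (fun y => fStarR f a b (h y - ν)) P → c ≤ ν + ∫ y, fStarR f a b (h y - ν) ∂P) :
    (c : EReal) ≤ cgf f a b P h := by
  refine le_iInf fun ν => ?_
  unfold eIntegral
  split_ifs with hi
  · rw [← EReal.coe_add]
    exact EReal.coe_le_coe_iff.2 (H ν hi.1 hi.2)
  · simp

lemma cgf_mem_Icc (ha0 : 0 ≤ a) (ha1 : a < 1) (hb1 : ((1 : ℝ) : EReal) < b)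
    (hconv : ConvexOn ℝ (Dom a b) f) (hf1 : f 1 = 0) (hh : Measurable h)
    (hbd : ∀ y, h y ∈ Icc α β) : cgf f a b P h ∈ Icc (α : EReal) (β : EReal) := by
  refine ⟨le_cgf fun ν hfin hi => ?_, ?_⟩
  · have : ∫ _, (α - ν) ∂P ≤ ∫ y, fStarR f a b (h y - ν) ∂P := by
      refine integral_mono_ae (integrable_const _) hi ?_
      filter_upwards [hfin] with y hy
      linarith [self_le_fStarR ha1 hb1 hf1 hy, (hbd y).1]
    simp only [integral_const, probReal_univ, one_smul] at this
    linarith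
  · have hz := fStar_zz_le ha1 hb1 hconv hf1
    have hzt : fStar f a b (zz f) ≠ ⊤ := ne_top_of_le_ne_top (EReal.coe_ne_top _) hz
    have hν : fStar f a b (β - (β - zz f)) ≠ ⊤ := by rwa [sub_sub_cancel]
    refine (cgf_le_integral ha0 ha1 hb1 hf1 hh hbd hν).trans (EReal.coe_le_coe_iff.2 ?_)
    have : ∫ y, fStarR f a b (h y - (β - zz f)) ∂P ≤ ∫ _, zz f ∂P := by
      refine integral_mono (integrable_fStarR_sub ha0 ha1 hb1 hf1 hh hbd hν) (integrable_const _)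
        fun y => ?_
      refine (fStarR_mono ha0 ha1 hb1 hf1 (by linarith [(hbd y).2]) hzt).trans ?_
      rwa [← EReal.coe_le_coe_iff, coe_fStarR ha1 hb1 hf1 hzt]
    simp only [integral_const, probReal_univ, one_smul] at this
    linarith

lemma coe_cgfR (ha0 : 0 ≤ a) (ha1 : a < 1) (hb1 : ((1 : ℝ) : EReal) < b)
    (hconv : ConvexOn ℝ (Dom a b) f) (hf1 : f 1 = 0) (hh : Measurable h)
    (hbd : ∀ y, h y ∈ Icc α β) : ((cgfR f a b P h : ℝ) : EReal) = cgf f a b P h := by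
  obtain ⟨h1, h2⟩ := cgf_mem_Icc (P := P) ha0 ha1 hb1 hconv hf1 hh hbd
  exact EReal.coe_toReal (ne_top_of_le_ne_top (EReal.coe_ne_top _) h2)
    (ne_bot_of_le_ne_bot (EReal.coe_ne_bot _) h1)

lemma cgfR_mem_Icc (ha0 : 0 ≤ a) (ha1 : a < 1) (hb1 : ((1 : ℝ) : EReal) < b)
    (hconv : ConvexOn ℝ (Dom a b) f) (hf1 : f 1 = 0) (hh : Measurable h)
    (hbd : ∀ y, h y ∈ Icc α β) : cgfR f a b P h ∈ Icc α β := by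
  have := cgf_mem_Icc (P := P) ha0 ha1 hb1 hconv hf1 hh hbd
  rw [← coe_cgfR ha0 ha1 hb1 hconv hf1 hh hbd] at this
  exact ⟨EReal.coe_le_coe_iff.1 this.1, EReal.coe_le_coe_iff.1 this.2⟩

lemma cgfR_le_add_rderiv_mul (ha0 : 0 ≤ a) (ha1 : a < 1) (hb1 : ((1 : ℝ) : EReal) < b)
    (hconv : ConvexOn ℝ (Dom a b) f) (hf1 : f 1 = 0)
    (hz : zz f + β - α ∈ interior {z : ℝ | fStar f a b z < ⊤})
    (hh : Measurable h) (hbd : ∀ y, h y ∈ Icc α β)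
    (hh' : Measurable h') (hbd' : ∀ y, h' y ∈ Icc α β) {s : ℝ} (hs : ∀ y, |h y - h' y| ≤ s) :
    cgfR f a b P h' ≤ cgfR f a b P h + rderiv (fStarR f a b) (zz f + β - α) * s := by
  obtain ⟨hK0, hK⟩ := fStarR_le_add_rderiv_mul ha0 ha1 hb1 hf1 hz
  set K := rderiv (fStarR f a b) (zz f + β - α)
  have hMt : fStar f a b (zz f + β - α) ≠ ⊤ :=
    ne_of_lt (show _ ∈ {z : ℝ | fStar f a b z < ⊤} from interior_subset hz)
  suffices ((cgfR f a b P h' - K * s : ℝ) : EReal) ≤ cgf f a b P h by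
    rw [← coe_cgfR ha0 ha1 hb1 hconv hf1 hh hbd, EReal.coe_le_coe_iff] at this
    linarith
  refine le_cgf fun ν hfin hi => ?_
  obtain ⟨ν', hν'⟩ : ∃ ν', ν' = max ν (α - zz f) := ⟨_, rfl⟩
  have hle : α - zz f ≤ ν' := hν' ▸ le_max_right _ _
  have hνt : fStar f a b (β - ν') ≠ ⊤ :=
    ne_top_of_le_ne_top hMt (monotone_fStar ha0 (by linarith))
  have hi1 := integrable_fStarR_sub (P := P) ha0 ha1 hb1 hf1 hh hbd hνt
  have hi2 := integrable_fStarR_sub (P := P) ha0 ha1 hb1 hf1 hh' hbd' hνt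
  have h1 : cgfR f a b P h' ≤ ν' + ∫ y, fStarR f a b (h' y - ν') ∂P := by
    rw [← EReal.coe_le_coe_iff, coe_cgfR ha0 ha1 hb1 hconv hf1 hh' hbd']
    exact cgf_le_integral ha0 ha1 hb1 hf1 hh' hbd' hνt
  have h2 : ∫ y, fStarR f a b (h' y - ν') ∂P ≤ ∫ y, (fStarR f a b (h y - ν') + K * s) ∂P := by
    refine integral_mono hi2 (hi1.add (integrable_const _)) fun y => ?_
    refine (hK (h' y - ν') (by linarith [(hbd' y).2]) (h y - ν') (by linarith [(hbd y).2])).trans ?_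
    have : |h' y - ν' - (h y - ν')| ≤ s := by
      rw [sub_sub_sub_cancel_right, abs_sub_comm]
      exact hs y
    exact add_le_add_right (mul_le_mul_of_nonneg_left this hK0) _
  have h3 : ∫ y, fStarR f a b (h y - ν') ∂P ≤ ∫ y, (fStarR f a b (h y - ν) + (ν - ν')) ∂P := by
    refine integral_mono_ae hi1 (hi.add (integrable_const _)) ?_
    filter_upwards [hfin] with y hy
    rcases le_total ν (α - zz f) with hc | hc
    · rw [max_eq_right hc] at hν'
      have := fStarR_sub_self_mono ha1 hb1 hconv hf1 (x := h y - ν') (y := h y - ν)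
        (by linarith [(hbd y).1]) (by linarith) hy
      linarith
    · rw [max_eq_left hc] at hν'
      simp [hν']
  rw [integral_add hi1 (integrable_const _)] at h2
  rw [integral_add hi (integrable_const _)] at h3
  simp only [integral_const, probReal_univ, one_smul] at h2 h3
  linarith

end Cumulant

section Divergence

variable {X : Type*} [MeasurableSpace X] {f : ℝ → ℝ} {a : ℝ} {b : EReal} {α β : ℝ}

lemma isProbabilityMeasure_empMeas {n : ℕ} (hn : 0 < n) (xs : Fin n → X) :
    IsProbabilityMeasure (empMeas n xs) := by
  constructor
  simp [empMeas, ENNReal.inv_mul_cancel, hn.ne']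

lemma integrable_of_measurable_of_mem_Icc {P : Measure X} [IsProbabilityMeasure P] {h : X → ℝ}
    (hh : Measurable h) (hbd : ∀ x, h x ∈ Icc α β) : Integrable h P :=
  Integrable.of_mem_Icc α β hh.aemeasurable (ae_of_all _ hbd)

lemma integral_mem_Icc {P : Measure X} [IsProbabilityMeasure P] {h : X → ℝ}
    (hh : Measurable h) (hbd : ∀ x, h x ∈ Icc α β) : ∫ x, h x ∂P ∈ Icc α β := by
  have hi := integrable_of_measurable_of_mem_Icc (P := P) hh hbd
  have h1 := integral_mono (integrable_const α) hi fun x => (hbd x).1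
  have h2 := integral_mono hi (integrable_const β) fun x => (hbd x).2
  simp only [integral_const, probReal_univ, one_smul] at h1 h2
  exact ⟨h1, h2⟩

variable {Γ Γt : Set (X → ℝ)} {Q P : Measure X} [IsProbabilityMeasure Q] [IsProbabilityMeasure P]

lemma integral_sub_cgfR_le_Dfg (ha0 : 0 ≤ a) (ha1 : a < 1) (hb1 : ((1 : ℝ) : EReal) < b)
    (hconv : ConvexOn ℝ (Dom a b) f) (hf1 : f 1 = 0) (hm : ∀ h ∈ Γ, Measurable h)
    (hbd : ∀ h ∈ Γ, ∀ x, h x ∈ Icc α β) {h : X → ℝ} (hh : h ∈ Γ) :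
    ∫ x, h x ∂Q - cgfR f a b P h ≤ Dfg f a b Γ Q P := by
  refine le_csSup ⟨β - α, ?_⟩ ⟨h, hh, rfl⟩
  rintro _ ⟨g, hg, rfl⟩
  linarith [(integral_mem_Icc (P := Q) (hm g hg) (hbd g hg)).2,
    (cgfR_mem_Icc (P := P) ha0 ha1 hb1 hconv hf1 (hm g hg) (hbd g hg)).1]

omit [IsProbabilityMeasure Q] [IsProbabilityMeasure P] in
lemma Dfg_le (hne : Γ.Nonempty) {c : ℝ} (H : ∀ h ∈ Γ, ∫ x, h x ∂Q - cgfR f a b P h ≤ c) :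
    Dfg f a b Γ Q P ≤ c := by
  obtain ⟨h, hh⟩ := hne
  refine csSup_le ⟨_, h, hh, rfl⟩ ?_
  rintro _ ⟨g, hg, rfl⟩
  exact H g hg

lemma sub_le_Dfg (ha0 : 0 ≤ a) (ha1 : a < 1) (hb1 : ((1 : ℝ) : EReal) < b)
    (hconv : ConvexOn ℝ (Dom a b) f) (hf1 : f 1 = 0) (hm : ∀ h ∈ Γ, Measurable h)
    (hbd : ∀ h ∈ Γ, ∀ x, h x ∈ Icc α β) (hne : Γ.Nonempty) : α - β ≤ Dfg f a b Γ Q P := by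
  obtain ⟨g, hg⟩ := hne
  refine le_trans ?_ (integral_sub_cgfR_le_Dfg ha0 ha1 hb1 hconv hf1 hm hbd hg)
  linarith [(integral_mem_Icc (P := Q) (hm g hg) (hbd g hg)).1,
    (cgfR_mem_Icc (P := P) ha0 ha1 hb1 hconv hf1 (hm g hg) (hbd g hg)).2]

lemma sInf_iSup_abs_sub_le_approxErr {X : Type*} [Nonempty X] {Γ Γt : Set (X → ℝ)}
    (hsub : Γt ⊆ Γ) (hne : Γt.Nonempty) (hbd : ∀ h ∈ Γ, ∀ x, h x ∈ Icc α β) {h : X → ℝ}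
    (hh : h ∈ Γ) :
    sInf {s : ℝ | ∃ ht ∈ Γt, s = ⨆ x, |h x - ht x|} ≤ approxErr Γ Γt := by
  refine le_csSup ⟨β - α, ?_⟩ ⟨h, hh, rfl⟩
  rintro _ ⟨g, hg, rfl⟩
  obtain ⟨k, hk⟩ := hne
  have hbelow : BddBelow {s : ℝ | ∃ ht ∈ Γt, s = ⨆ x, |g x - ht x|} := by
    refine ⟨0, ?_⟩
    rintro _ ⟨l, -, rfl⟩
    exact Real.iSup_nonneg fun x => abs_nonneg _
  refine (csInf_le hbelow ⟨k, hk, rfl⟩).trans (ciSup_le fun x => ?_)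
  exact abs_sub_le_of_le_of_le (hbd g hg x).1 (hbd g hg x).2 (hbd k (hsub hk) x).1
    (hbd k (hsub hk) x).2

/-- Shrinking the function space from `Γ` to `Γt` costs at most a multiple of the approximation
error. -/
lemma Dfg_le_Dfg_add_approxErr (ha0 : 0 ≤ a) (ha1 : a < 1) (hb1 : ((1 : ℝ) : EReal) < b)
    (hconv : ConvexOn ℝ (Dom a b) f) (hf1 : f 1 = 0)
    (hz : zz f + β - α ∈ interior {z : ℝ | fStar f a b z < ⊤})
    (hm : ∀ h ∈ Γ, Measurable h) (hbd : ∀ h ∈ Γ, ∀ x, h x ∈ Icc α β)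
    (hsub : Γt ⊆ Γ) (hne : Γt.Nonempty) :
    Dfg f a b Γ Q P ≤
      Dfg f a b Γt Q P + (1 + rderiv (fStarR f a b) (zz f + β - α)) * approxErr Γ Γt := by
  have hX : Nonempty X := nonempty_of_isProbabilityMeasure Q
  have hK0 := (fStarR_le_add_rderiv_mul ha0 ha1 hb1 hf1 hz).1
  set K := rderiv (fStarR f a b) (zz f + β - α)
  refine Dfg_le (hne.mono hsub) fun h hh => ?_
  have key : (∫ x, h x ∂Q - cgfR f a b P h - Dfg f a b Γt Q P) / (1 + K) ≤
      sInf {s : ℝ | ∃ ht ∈ Γt, s = ⨆ x, |h x - ht x|} := by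
    obtain ⟨k, hk⟩ := hne
    refine le_csInf ⟨_, k, hk, rfl⟩ ?_
    rintro _ ⟨g, hg, rfl⟩
    have hgΓ := hsub hg
    have hs : ∀ x, |h x - g x| ≤ ⨆ x, |h x - g x| := le_ciSup ⟨β - α, by
      rintro _ ⟨x, rfl⟩
      exact abs_sub_le_of_le_of_le (hbd h hh x).1 (hbd h hh x).2 (hbd g hgΓ x).1 (hbd g hgΓ x).2⟩
    set s := ⨆ x, |h x - g x|
    have h1 := integral_sub_cgfR_le_Dfg (Q := Q) (P := P) ha0 ha1 hb1 hconv hf1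
      (fun h hh => hm h (hsub hh)) (fun h hh => hbd h (hsub hh)) hg
    have h2 := cgfR_le_add_rderiv_mul (P := P) ha0 ha1 hb1 hconv hf1 hz (hm h hh) (hbd h hh)
      (hm g hgΓ) (hbd g hgΓ) hs
    have hig := integrable_of_measurable_of_mem_Icc (P := Q) (hm g hgΓ) (hbd g hgΓ)
    have h3 : ∫ x, h x ∂Q ≤ ∫ x, (g x + s) ∂Q :=
      integral_mono (integrable_of_measurable_of_mem_Icc (hm h hh) (hbd h hh))
        (hig.add (integrable_const s)) fun x => by
          have := (abs_le.1 (hs x)).2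
          simp only
          linarith
    rw [integral_add hig (integrable_const s)] at h3
    simp only [integral_const, probReal_univ, one_smul] at h3
    rw [div_le_iff₀ (by linarith)]
    linarith
  rw [div_le_iff₀ (by linarith)] at key
  nlinarith [mul_le_mul_of_nonneg_left (sInf_iSup_abs_sub_le_approxErr hsub hne hbd hh)
    (show 0 ≤ 1 + K by linarith)]

end Divergence

open MeasureTheory in
/-- `(f,Γ)`-GAN error decomposition under the zero generator
approximation error property. -/
theorem stmt10
    {X : Type*} [TopologicalSpace X] [MeasurableSpace X] [BorelSpace X]
    (f : ℝ → ℝ) (a : ℝ) (b : EReal) (α β : ℝ)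
    (ha0 : 0 ≤ a) (ha1 : a < 1) (hb1 : ((1 : ℝ) : EReal) < b)
    (hconv : ConvexOn ℝ (Dom a b) f) (hf1 : f 1 = 0)
    (hstrict : ∃ ε > 0, Set.Ioo (1 - ε) (1 + ε) ⊆ Dom a b ∧
      StrictConvexOn ℝ (Set.Ioo (1 - ε) (1 + ε)) f)
    (hz : zz f + β - α ∈ interior {z : ℝ | fStar f a b z < ⊤})
    (hαβ : α ≤ β)
    (Γt Γ : Set (X → ℝ)) (hsub : Γt ⊆ Γ) (hΓtne : Γt.Nonempty)
    (hcont : ∀ h ∈ Γ, Continuous h) (hbd : ∀ h ∈ Γ, ∀ x, h x ∈ Set.Icc α β)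
    (hΓd : PtwiseDenseCount Γ) (hΓtd : PtwiseDenseCount Γt)
    {Z : Type*} [MeasurableSpace Z] (PZ : Measure Z) [IsProbabilityMeasure PZ]
    {Θ : Type*} [MetricSpace Θ] [TopologicalSpace.SeparableSpace Θ] [Nonempty Θ]
    [MeasurableSpace Θ] [BorelSpace Θ]
    (Φ : Θ → Z → X) (hΦm : ∀ θ, Measurable (Φ θ)) (hΦc : ∀ z, Continuous fun θ => Φ θ z)
    (Q : Measure X) [IsProbabilityMeasure Q]
    {Ω : Type*} [MeasurableSpace Ω] (ℙ : Measure Ω) [IsProbabilityMeasure ℙ]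
    (n m : ℕ) (hn : 0 < n) (hm : 0 < m)
    (Xs : Fin n → Ω → X) (Zs : Fin m → Ω → Z)
    (hXm : ∀ i, Measurable (Xs i)) (hZm : ∀ j, Measurable (Zs j))
    (hlaw : Measure.map (fun ω => (fun i => Xs i ω, fun j => Zs j ω)) ℙ =
      (Measure.pi fun _ : Fin n => Q).prod (Measure.pi fun _ : Fin m => PZ))
    (θstar : Ω → Θ) (hθm : Measurable θstar)
    (εopt : ℝ) (hεopt : 0 ≤ εopt)
    (hopt : ∀ᵐ ω ∂ℙ,
      Dfg f a b Γt (empMeas n fun i => Xs i ω)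
          (Measure.map (Φ (θstar ω)) (empMeas m fun j => Zs j ω)) ≤
        (⨅ θ : Θ, Dfg f a b Γt (empMeas n fun i => Xs i ω)
          (Measure.map (Φ θ) (empMeas m fun j => Zs j ω))) + εopt)
    (hzero : ∀ xs : Fin n → X,
      (⨅ θ : Θ, Dfg f a b Γt (empMeas n xs) (Measure.map (Φ θ) PZ)) = 0) :
    ∀ᵐ ω ∂ℙ,
      Dfg f a b Γ Q (Measure.map (Φ (θstar ω)) PZ) ≤
        sSup {r : ℝ | ∃ h ∈ Γt, ∃ θ : Θ,
            r = cgfR f a b (empMeas m fun j => Zs j ω) (fun z => h (Φ θ z))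
              - cgfR f a b PZ (fun z => h (Φ θ z))}
        + sSup {r : ℝ | ∃ h ∈ Γt, ∃ θ : Θ,
            r = cgfR f a b PZ (fun z => h (Φ θ z))
              - cgfR f a b (empMeas m fun j => Zs j ω) (fun z => h (Φ θ z))}
        + sSup {r : ℝ | ∃ h ∈ Γt,
            r = (∫ x, h x ∂Q) - ∫ x, h x ∂(empMeas n fun i => Xs i ω)}
        + (1 + rderiv (fStarR f a b) (zz f + β - α)) * approxErr Γ Γt
        + εopt := by
  have hm' : ∀ h ∈ Γ, Measurable h := fun h hh => (hcont h hh).measurable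
  have hmt : ∀ h ∈ Γt, Measurable h := fun h hh => hm' h (hsub hh)
  have hbdt : ∀ h ∈ Γt, ∀ x, h x ∈ Set.Icc α β := fun h hh => hbd h (hsub hh)
  filter_upwards [hopt] with ω hω
  have hQn := isProbabilityMeasure_empMeas hn fun i => Xs i ω
  have hPm := isProbabilityMeasure_empMeas hm fun j => Zs j ω
  have hz0 := hzero fun i => Xs i ω
  set Qn := empMeas n fun i => Xs i ω
  set Pm := empMeas m fun j => Zs j ω
  have hP : ∀ θ, IsProbabilityMeasure (Measure.map (Φ θ) PZ) := fun θ =>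
    Measure.isProbabilityMeasure_map (hΦm θ).aemeasurable
  have hPn : ∀ θ, IsProbabilityMeasure (Measure.map (Φ θ) Pm) := fun θ =>
    Measure.isProbabilityMeasure_map (hΦm θ).aemeasurable
  have hcgf : ∀ (R : Measure Z) [IsProbabilityMeasure R], ∀ h ∈ Γt, ∀ θ,
      cgfR f a b R (fun z => h (Φ θ z)) ∈ Set.Icc α β := fun R _ h hh θ =>
    cgfR_mem_Icc ha0 ha1 hb1 hconv hf1 ((hmt h hh).comp (hΦm θ)) fun z => hbdt h hh _
  have hsup : ∀ (R S : Measure Z) [IsProbabilityMeasure R] [IsProbabilityMeasure S],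
      ∀ h ∈ Γt, ∀ θ, cgfR f a b (Measure.map (Φ θ) R) h - cgfR f a b (Measure.map (Φ θ) S) h ≤
        sSup {r : ℝ | ∃ h ∈ Γt, ∃ θ : Θ, r = cgfR f a b R (fun z => h (Φ θ z))
          - cgfR f a b S (fun z => h (Φ θ z))} := by
    intro R S _ _ h hh θ
    rw [cgfR_map ha0 (hΦm θ) R (hmt h hh), cgfR_map ha0 (hΦm θ) S (hmt h hh)]
    refine le_csSup ⟨β - α, ?_⟩ ⟨h, hh, θ, rfl⟩
    rintro _ ⟨g, hg, η, rfl⟩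
    linarith [(hcgf R g hg η).2, (hcgf S g hg η).1]
  have hgen : ∀ (R S : Measure Z) [IsProbabilityMeasure R] [IsProbabilityMeasure S] (θ : Θ),
      Dfg f a b Γt Qn (Measure.map (Φ θ) S) ≤ Dfg f a b Γt Qn (Measure.map (Φ θ) R) +
        sSup {r : ℝ | ∃ h ∈ Γt, ∃ θ : Θ, r = cgfR f a b R (fun z => h (Φ θ z))
          - cgfR f a b S (fun z => h (Φ θ z))} := by
    intro R S _ _ θ
    have := Measure.isProbabilityMeasure_map (μ := R) (hΦm θ).aemeasurable
    refine Dfg_le hΓtne fun h hh => ?_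
    linarith [hsup R S h hh θ, integral_sub_cgfR_le_Dfg (Q := Qn) (P := Measure.map (Φ θ) R)
      ha0 ha1 hb1 hconv hf1 hmt hbdt hh]
  have hemp : Dfg f a b Γt Q (Measure.map (Φ (θstar ω)) PZ) ≤
      Dfg f a b Γt Qn (Measure.map (Φ (θstar ω)) PZ) +
        sSup {r : ℝ | ∃ h ∈ Γt, r = (∫ x, h x ∂Q) - ∫ x, h x ∂Qn} := by
    refine Dfg_le hΓtne fun h hh => ?_
    have h1 : (∫ x, h x ∂Q) - ∫ x, h x ∂Qn ≤
        sSup {r : ℝ | ∃ h ∈ Γt, r = (∫ x, h x ∂Q) - ∫ x, h x ∂Qn} := by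
      refine le_csSup ⟨β - α, ?_⟩ ⟨h, hh, rfl⟩
      rintro _ ⟨g, hg, rfl⟩
      linarith [(integral_mem_Icc (P := Q) (hmt g hg) (hbdt g hg)).2,
        (integral_mem_Icc (P := Qn) (hmt g hg) (hbdt g hg)).1]
    linarith [integral_sub_cgfR_le_Dfg (Q := Qn) (P := Measure.map (Φ (θstar ω)) PZ)
      ha0 ha1 hb1 hconv hf1 hmt hbdt hh]
  have hinf : (⨅ θ : Θ, Dfg f a b Γt Qn (Measure.map (Φ θ) Pm)) -
      sSup {r : ℝ | ∃ h ∈ Γt, ∃ θ : Θ, r = cgfR f a b PZ (fun z => h (Φ θ z))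
        - cgfR f a b Pm (fun z => h (Φ θ z))} ≤
      ⨅ θ : Θ, Dfg f a b Γt Qn (Measure.map (Φ θ) PZ) := by
    refine le_ciInf fun θ => ?_
    have h1 : (⨅ θ : Θ, Dfg f a b Γt Qn (Measure.map (Φ θ) Pm)) ≤
        Dfg f a b Γt Qn (Measure.map (Φ θ) Pm) := by
      refine ciInf_le ⟨α - β, ?_⟩ θ
      rintro _ ⟨η, rfl⟩
      exact sub_le_Dfg ha0 ha1 hb1 hconv hf1 hmt hbdt hΓtne
    linarith [hgen PZ Pm θ]
  rw [hz0] at hinf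
  have happrox := Dfg_le_Dfg_add_approxErr (Q := Q) (P := Measure.map (Φ (θstar ω)) PZ)
    ha0 ha1 hb1 hconv hf1 hz hm' hbd hsub hΓtne
  linarith [hgen Pm PZ (θstar ω)]
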